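/- arXiv:1208.1420 — 2 statements merged into one kernel-verified Lean document; each statement's English description precedes it below -/
import Mathlib

section
/- For all n ≥ 1 and 1 ≤ m ≤ n, the number T(n,m) of marked Stirling permutations of order n with exactly m descents equals 2^{n-m} C(n,m), where C(n,m) is the second-order Eulerian number; equivalently, Σ_m T(n,m) x^m = 2^n C_n(x/2) where C_n(x) = Σ_k C(n,k) x^k. -/
open Finset

noncomputable section
open scoped Classical

/-- The letter at (1-based) position `i` of the word encoded by `w`, with the
convention that positions outside `[1, 2n]` carry the value `0`. -/
def spVal (n : ℕ) (w : Fin (2*n) → Fin (n+1)) (i : ℕ) : ℕ :=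
  if h : 1 ≤ i ∧ i ≤ 2*n then (w ⟨i - 1, by omega⟩ : ℕ) else 0

/-- `w` encodes a Stirling permutation of order `n`. -/
def IsSP (n : ℕ) (w : Fin (2*n) → Fin (n+1)) : Prop :=
  (∀ v ∈ Finset.Icc 1 n,
      ((Finset.Icc 1 (2*n)).filter fun i => spVal n w i = v).card = 2) ∧
  ∀ i k j : ℕ, 1 ≤ i → i < k → k < j → j ≤ 2*n →
    spVal n w i = spVal n w j → spVal n w i < spVal n w k

/-- `(w, S)` encodes a marked Stirling permutation of order `n`. -/
def IsMSP (n : ℕ) (w : Fin (2*n) → Fin (n+1)) (S : Finset (Fin (2*n))) : Prop :=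
  IsSP n w ∧ ∀ p ∈ S, (∃ q : Fin (2*n), q < p ∧ w q = w p) ∧
    spVal n w ((p : ℕ) + 1) < spVal n w ((p : ℕ) + 2)

/-- The descent set of a (marked) Stirling permutation (with `π_{2n+1} = 0`). -/
def spDes (n : ℕ) (w : Fin (2*n) → Fin (n+1)) : Finset ℕ :=
  (Finset.Icc 1 (2*n)).filter fun i => spVal n w (i+1) < spVal n w i

/-- The second-order Eulerian number `C(n,m)`. -/
def secondEulerian (n m : ℕ) : ℕ :=
  Nat.card {w : Fin (2*n) → Fin (n+1) // IsSP n w ∧ (spDes n w).card = m}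

/-- `T(n,m)`: the number of marked Stirling permutations of order `n` with
exactly `m` descents. -/
def Tnum (n m : ℕ) : ℕ :=
  Nat.card {ws : (Fin (2*n) → Fin (n+1)) × Finset (Fin (2*n)) //
    IsMSP n ws.1 ws.2 ∧ (spDes n ws.1).card = m}

/-- Every letter of a Stirling permutation is positive. -/
theorem IsSP.spVal_pos {n : ℕ} {w : Fin (2*n) → Fin (n+1)} (h : IsSP n w) {i : ℕ}
    (hi : i ∈ Finset.Icc 1 (2*n)) : 0 < spVal n w i := by
  have hmaps : ∀ i ∈ Finset.Icc 1 (2*n), spVal n w i ∈ Finset.range (n+1) := by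
    intro i _
    unfold spVal
    split_ifs
    · exact Finset.mem_range.2 (Fin.is_lt _)
    · simp
  have hsum := Finset.card_eq_sum_card_fiberwise hmaps
  rw [Finset.sum_range_succ'] at hsum
  have htwo : ∀ k ∈ Finset.range n,
      ((Finset.Icc 1 (2*n)).filter fun i => spVal n w i = k + 1).card = 2 := by
    intro k hk
    have := Finset.mem_range.1 hk
    exact h.1 (k+1) (Finset.mem_Icc.2 ⟨by omega, by omega⟩)
  rw [Finset.sum_congr rfl htwo] at hsum
  simp only [Finset.sum_const, Finset.card_range, smul_eq_mul, Nat.card_Icc] at hsum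
  have hzero : ((Finset.Icc 1 (2*n)).filter fun i => spVal n w i = 0).card = 0 := by omega
  rw [Finset.card_eq_zero, Finset.filter_eq_empty_iff] at hzero
  exact Nat.pos_of_ne_zero (hzero hi)

theorem spVal_le {n : ℕ} (w : Fin (2*n) → Fin (n+1)) (i : ℕ) : spVal n w i ≤ n := by
  unfold spVal
  split_ifs
  · exact Nat.lt_succ_iff.1 (Fin.is_lt _)
  · simp

theorem mem_Icc_of_spVal_pos {n : ℕ} {w : Fin (2*n) → Fin (n+1)} {i : ℕ}
    (h : 0 < spVal n w i) : i ∈ Finset.Icc 1 (2*n) := by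
  by_contra hi
  rw [Finset.mem_Icc] at hi
  simp [spVal, hi] at h

/-- The positions holding the second occurrence of their letter. -/
def secondOcc (n : ℕ) (w : Fin (2*n) → Fin (n+1)) : Finset ℕ :=
  (Finset.Icc 1 (2*n)).filter fun i => ∃ j, 1 ≤ j ∧ j < i ∧ spVal n w j = spVal n w i

/-- The second occurrences of letters that are followed by a larger letter. -/
def markable (n : ℕ) (w : Fin (2*n) → Fin (n+1)) : Finset (Fin (2*n)) :=
  Finset.univ.filter fun p => (∃ q : Fin (2*n), q < p ∧ w q = w p) ∧
    spVal n w ((p : ℕ) + 1) < spVal n w ((p : ℕ) + 2)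

theorem IsSP.card_secondOcc {n : ℕ} {w : Fin (2*n) → Fin (n+1)} (h : IsSP n w) :
    (secondOcc n w).card = n := by
  have hcard : (secondOcc n w).card = (Finset.Icc 1 n).card := by
    refine Finset.card_bij (fun i _ => spVal n w i) ?_ ?_ ?_
    · intro i hi
      exact Finset.mem_Icc.2 ⟨h.spVal_pos (Finset.mem_filter.1 hi).1, spVal_le w i⟩
    · intro i hi i' hi' heq
      simp only [secondOcc, Finset.mem_filter, Finset.mem_Icc] at hi hi'
      obtain ⟨hi, j, hj, hji, hjv⟩ := hi
      obtain ⟨hi', j', hj', hji', hjv'⟩ := hi'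
      rcases lt_trichotomy i i' with hlt | heq' | hlt
      · have := h.2 j i i' hj hji hlt hi'.2 (by omega)
        omega
      · exact heq'
      · have := h.2 j' i' i hj' hji' hlt hi.2 (by omega)
        omega
    · intro v hv
      obtain ⟨a, b, hab, hfib⟩ := Finset.card_eq_two.1 (h.1 v hv)
      have ha : a ∈ (Finset.Icc 1 (2*n)).filter fun i => spVal n w i = v := by simp [hfib]
      have hb : b ∈ (Finset.Icc 1 (2*n)).filter fun i => spVal n w i = v := by simp [hfib]
      simp only [Finset.mem_filter, Finset.mem_Icc] at ha hb
      rcases lt_or_gt_of_ne hab with hlt | hlt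
      · exact ⟨b, Finset.mem_filter.2 ⟨Finset.mem_Icc.2 hb.1, a, ha.1.1, hlt, by omega⟩, hb.2⟩
      · exact ⟨a, Finset.mem_filter.2 ⟨Finset.mem_Icc.2 ha.1, b, hb.1.1, hlt, by omega⟩, ha.2⟩
  simpa using hcard

/-- In a Stirling permutation every descent starts at a second occurrence. -/
theorem IsSP.spDes_subset_secondOcc {n : ℕ} {w : Fin (2*n) → Fin (n+1)} (h : IsSP n w) :
    spDes n w ⊆ secondOcc n w := by
  intro i hi
  obtain ⟨hi, hdes⟩ := Finset.mem_filter.1 hi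
  refine Finset.mem_filter.2 ⟨hi, ?_⟩
  have hv : spVal n w i ∈ Finset.Icc 1 n :=
    Finset.mem_Icc.2 ⟨h.spVal_pos hi, spVal_le w i⟩
  obtain ⟨j, hj, hji⟩ := Finset.exists_mem_ne (by rw [h.1 _ hv]; omega) i
  simp only [Finset.mem_filter, Finset.mem_Icc] at hj hi
  rcases lt_or_gt_of_ne hji with hlt | hlt
  · exact ⟨j, hj.1.1, hlt, hj.2⟩
  · rcases eq_or_lt_of_le (Nat.succ_le_of_lt hlt) with heq | hlt'
    · rw [Nat.succ_eq_add_one] at heq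
      rw [heq, hj.2] at hdes
      exact absurd hdes (lt_irrefl _)
    · have := h.2 i (i+1) j hi.1 (by omega) hlt' hj.1.2 hj.2.symm
      omega

theorem spVal_succ {n : ℕ} (w : Fin (2*n) → Fin (n+1)) (p : Fin (2*n)) :
    spVal n w ((p : ℕ) + 1) = w p := by
  have := p.is_lt
  simp [spVal]

/-- The markable positions are the second occurrences that are not descents. -/
theorem IsSP.image_markable {n : ℕ} {w : Fin (2*n) → Fin (n+1)} (h : IsSP n w) :
    (markable n w).image (fun p : Fin (2*n) => (p : ℕ) + 1) = secondOcc n w \ spDes n w := by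
  ext i
  simp only [Finset.mem_image, Finset.mem_sdiff, markable, Finset.mem_filter, Finset.mem_univ,
    true_and, secondOcc, spDes, Finset.mem_Icc]
  constructor
  · rintro ⟨p, ⟨⟨q, hqp, hq⟩, hasc⟩, rfl⟩
    have hp := p.is_lt
    refine ⟨⟨by omega, (q : ℕ) + 1, by omega, by simpa using hqp, ?_⟩, fun hdes => ?_⟩
    · rw [spVal_succ, spVal_succ, hq]
    · have := hdes.2
      rw [show (p : ℕ) + 1 + 1 = p + 2 from rfl] at this
      omega
  · rintro ⟨⟨hi, j, hj, hji, hv⟩, hdes⟩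
    refine ⟨⟨i - 1, by omega⟩, ⟨⟨⟨j - 1, by omega⟩, ?_, ?_⟩, ?_⟩, ?_⟩
    · simp only [Fin.mk_lt_mk]
      omega
    · apply Fin.ext
      rw [← spVal_succ, ← spVal_succ]
      simpa only [Nat.sub_add_cancel hj, Nat.sub_add_cancel hi.1] using hv
    · have hle : spVal n w i ≤ spVal n w (i+1) := by
        by_contra hlt
        exact hdes ⟨hi, not_le.1 hlt⟩
      have hne : spVal n w i ≠ spVal n w (i+1) := by
        intro heq
        have hpos := h.spVal_pos (Finset.mem_Icc.2 hi)
        rw [heq] at hpos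
        have := h.2 j i (i+1) hj hji (by omega)
          (Finset.mem_Icc.1 (mem_Icc_of_spVal_pos hpos)).2 (by omega)
        omega
      simp only [show i - 1 + 1 = i by omega, show i - 1 + 2 = i + 1 by omega]
      omega
    · simp only
      omega

theorem IsSP.card_markable {n : ℕ} {w : Fin (2*n) → Fin (n+1)} (h : IsSP n w) :
    (markable n w).card = n - (spDes n w).card := by
  rw [← Finset.card_image_of_injective (f := fun p : Fin (2*n) => (p : ℕ) + 1) (markable n w)
    (fun a b hab => Fin.ext (by simpa using hab)), h.image_markable,
    Finset.card_sdiff_of_subset h.spDes_subset_secondOcc, h.card_secondOcc]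

theorem isMSP_iff {n : ℕ} {w : Fin (2*n) → Fin (n+1)} {S : Finset (Fin (2*n))} :
    IsMSP n w S ↔ IsSP n w ∧ S ∈ (markable n w).powerset := by
  simp [IsMSP, markable, Finset.subset_iff]

/-- A marked Stirling permutation is a Stirling permutation with a set of markable positions. -/
def markedEquivSigma (n m : ℕ) :
    {ws : (Fin (2*n) → Fin (n+1)) × Finset (Fin (2*n)) //
      IsMSP n ws.1 ws.2 ∧ (spDes n ws.1).card = m} ≃
    Σ w : {w : Fin (2*n) → Fin (n+1) // IsSP n w ∧ (spDes n w).card = m},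
      {S // S ∈ (markable n w.1).powerset} where
  toFun ws := ⟨⟨ws.1.1, (isMSP_iff.1 ws.2.1).1, ws.2.2⟩, ws.1.2, (isMSP_iff.1 ws.2.1).2⟩
  invFun x := ⟨(x.1.1, x.2.1), isMSP_iff.2 ⟨x.1.2.1, x.2.2⟩, x.1.2.2⟩
  left_inv _ := rfl
  right_inv _ := rfl

/-- For all `n ≥ 1` and `1 ≤ m ≤ n`, `T(n,m) = 2^{n-m} C(n,m)`. -/
theorem Tnum_eq_two_pow_mul_secondEulerian (n m : ℕ) (hn : 1 ≤ n)
    (hm : 1 ≤ m) (hmn : m ≤ n) :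
    Tnum n m = 2 ^ (n - m) * secondEulerian n m := by
  rw [Tnum, secondEulerian, Nat.card_congr (markedEquivSigma n m), Nat.card_sigma]
  have hfiber : ∀ w : {w : Fin (2*n) → Fin (n+1) // IsSP n w ∧ (spDes n w).card = m},
      Nat.card {S // S ∈ (markable n w.1).powerset} = 2 ^ (n - m) := by
    intro w
    rw [Nat.card_eq_fintype_card, Fintype.card_coe, Finset.card_powerset,
      w.2.1.card_markable, w.2.2]
  simp only [hfiber, Finset.sum_const, Finset.card_univ, Nat.card_eq_fintype_card, smul_eq_mul]
  ring
end
end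

section
/- Let n ≥ 0 and let D_{n+1} be the unique ℂ-derivation of ℂ[x_0,…,x_{n+1}, y_0,…,y_{n+1}, z_0,…,z_{n+1}] with D_{n+1}(x_i) = D_{n+1}(y_i) = D_{n+1}(z_i) = x_{n+1} y_{n+1} z_{n+1} for all 0 ≤ i ≤ n and D_{n+1}(x_{n+1}) = D_{n+1}(y_{n+1}) = D_{n+1}(z_{n+1}) = 0. Then for every stable multiaffine polynomial f in the variables x_0,…,x_n, y_0,…,y_n, z_0,…,z_n, the polynomial D_{n+1}(f) is stable or identically zero. -/
open Finset MvPolynomial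

noncomputable section
open scoped Classical

/-- A polynomial over `ℂ` is stable if it does not vanish whenever all the
variables have positive imaginary part. -/
def IsStable {σ : Type*} (f : MvPolynomial σ ℂ) : Prop :=
  ∀ x : σ → ℂ, (∀ i, 0 < (x i).im) → MvPolynomial.eval x f ≠ 0

namespace MvPolynomial

variable {σ : Type*}

/-- A polynomial of degree at most one in `v` is affine in the value at `v`, with slope its partial
derivative. -/
theorem eval_update_of_degree_le_one {R : Type*} [CommRing R] (f : MvPolynomial σ R) (v : σ)
    (hf : ∀ m ∈ f.support, m v ≤ 1) (x : σ → R) (z : R) :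
    eval (Function.update x v z) f = eval x f + (z - x v) * eval x (pderiv v f) := by
  have key : ∀ m ∈ f.support, eval (Function.update x v z) (monomial m (coeff m f)) =
      eval x (monomial m (coeff m f)) +
        (z - x v) * eval x (pderiv v (monomial m (coeff m f))) := by
    intro m hm
    have herase : (m.erase v).prod (fun i e => Function.update x v z i ^ e) =
        (m.erase v).prod (fun i e => x i ^ e) := by
      refine Finsupp.prod_congr fun i hi => ?_
      rw [Finsupp.support_erase, Finset.mem_erase] at hi
      rw [Function.update_of_ne hi.1]
    have hsplit (y : σ → R) : m.prod (fun i e => y i ^ e) =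
        y v ^ m v * (m.erase v).prod (fun i e => y i ^ e) :=
      (Finsupp.mul_prod_erase' m v _ fun i => pow_zero _).symm
    rw [pderiv_monomial, eval_monomial, eval_monomial, eval_monomial, hsplit, hsplit x, herase,
      Function.update_self]
    rcases Nat.le_one_iff_eq_zero_or_eq_one.mp (hf m hm) with h | h
    · simp [h]
    · have hsub : m - Finsupp.single v 1 = m.erase v := by
        ext i
        by_cases hi : i = v
        · subst hi; simp [h]
        · simp [hi]
      rw [h, hsub]
      push_cast
      ring
  have hsum := Finset.sum_congr rfl key
  rw [Finset.sum_add_distrib, ← Finset.mul_sum] at hsum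
  simp only [← map_sum, support_sum_monomial_coeff] at hsum
  exact hsum

/-- The chain rule for a derivation of a polynomial ring. -/
theorem derivation_eq_sum_vars {R : Type*} [CommRing R]
    (D : Derivation R (MvPolynomial σ R) (MvPolynomial σ R)) (f : MvPolynomial σ R) :
    D f = ∑ v ∈ f.vars, D (X v) * pderiv v f := by
  let E : Derivation R (MvPolynomial σ R) (MvPolynomial σ R) := ∑ v ∈ f.vars, D (X v) • pderiv v
  have hE (p : MvPolynomial σ R) : E p = ∑ v ∈ f.vars, D (X v) * pderiv v p := by
    have h := map_sum Derivation.coeFnAddMonoidHom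
      (fun v => D (X v) • (pderiv v : Derivation R (MvPolynomial σ R) (MvPolynomial σ R))) f.vars
    simpa only [Derivation.coeFnAddMonoidHom_apply, Finset.sum_apply, Derivation.coe_smul,
      Pi.smul_apply, smul_eq_mul] using congrFun h p
  rw [derivation_eq_of_forall_mem_vars (D₂ := E) (f := f) (fun i hi => ?_), hE]
  rw [hE, Finset.sum_eq_single_of_mem i hi fun v _ hv => by rw [pderiv_X_of_ne hv.symm, mul_zero],
    pderiv_X_self, mul_one]

end MvPolynomial

namespace IsStable

variable {σ : Type*} {f : MvPolynomial σ ℂ}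

theorem im_eval_div_pderiv_pos (hf : IsStable f) {v : σ} (hv : ∀ m ∈ f.support, m v ≤ 1)
    {x : σ → ℂ} (hx : ∀ i, 0 < (x i).im) (hd : eval x (pderiv v f) ≠ 0) :
    0 < (eval x f / eval x (pderiv v f)).im := by
  by_contra! hle
  refine hf (Function.update x v (x v - eval x f / eval x (pderiv v f))) (fun i => ?_) ?_
  · by_cases hi : i = v
    · subst hi
      rw [Function.update_self, Complex.sub_im]
      linarith [hx i]
    · rw [Function.update_of_ne hi]
      exact hx i
  · rw [eval_update_of_degree_le_one f v hv]
    field_simp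
    ring

theorem im_pderiv_div_eval_neg (hf : IsStable f) {v : σ} (hv : ∀ m ∈ f.support, m v ≤ 1)
    {x : σ → ℂ} (hx : ∀ i, 0 < (x i).im) (hd : eval x (pderiv v f) ≠ 0) :
    (eval x (pderiv v f) / eval x f).im < 0 := by
  have h := hf.im_eval_div_pderiv_pos hv hx hd
  rw [← inv_div, Complex.inv_im]
  exact div_neg_of_neg_of_pos (neg_lt_zero.mpr h)
    (Complex.normSq_pos.mpr (div_ne_zero (hf x hx) hd))

theorem im_pderiv_div_eval_nonpos (hf : IsStable f) {v : σ} (hv : ∀ m ∈ f.support, m v ≤ 1)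
    {x : σ → ℂ} (hx : ∀ i, 0 < (x i).im) : (eval x (pderiv v f) / eval x f).im ≤ 0 := by
  by_cases hd : eval x (pderiv v f) = 0
  · simp [hd]
  · exact (hf.im_pderiv_div_eval_neg hv hx hd).le

/-- A partial derivative of a stable polynomial, in a variable of degree at most one, is stable or
zero: at an interior zero of the derivative the open mapping theorem would let the logarithmic
derivative take values in the upper half plane. -/
theorem pderiv (hf : IsStable f) {v : σ} (hv : ∀ m ∈ f.support, m v ≤ 1)
    (hne : MvPolynomial.pderiv v f ≠ 0) : IsStable (MvPolynomial.pderiv v f) := by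
  intro x hx hzero
  obtain ⟨y, hy⟩ : ∃ y, eval y (MvPolynomial.pderiv v f) ≠ 0 := by
    by_contra! h
    exact hne (MvPolynomial.funext fun y => by simp [h y])
  set q := MvPolynomial.pderiv v f
  let u : ℂ → σ → ℂ := fun s i => if i ∈ q.vars then x i + s * (y i - x i) else x i
  have hu0 : u 0 = x := by ext i; simp [u]
  have hu1 : eval (u 1) q = eval y q :=
    hom_congr_vars (by ext; simp) (fun i hi _ => by simp [u, hi]) rfl
  have hu (i : σ) : AnalyticOnNhd ℂ (fun s => u s i) Set.univ := by
    intro s _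
    simp only [u]
    split_ifs <;> fun_prop
  have han (p : MvPolynomial σ ℂ) : AnalyticOnNhd ℂ (fun s => eval (u s) p) Set.univ := by
    intro s _
    induction p using MvPolynomial.induction_on with
    | C a => simpa using analyticAt_const
    | add p q hp hq => simpa using! hp.add hq
    | mul_X p i hp => simpa using! hp.mul (hu i s trivial)
  have hpos : ∀ᶠ s in nhds (0 : ℂ), ∀ i, 0 < (u s i).im := by
    have h : ∀ᶠ s in nhds (0 : ℂ), ∀ i ∈ q.vars, 0 < (u s i).im := by
      rw [Filter.eventually_all_finset]
      intro i _
      refine (Complex.continuous_im.continuousAt.comp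
        (hu i 0 trivial).continuousAt).eventually (lt_mem_nhds ?_)
      simpa [hu0] using hx i
    filter_upwards [h] with s hs i
    by_cases hi : i ∈ q.vars
    · exact hs i hi
    · simpa [u, hi] using hx i
  have hdiv : AnalyticAt ℂ (fun s => eval (u s) q / eval (u s) f) 0 :=
    (han q 0 trivial).div (han f 0 trivial) (by rw [hu0]; exact hf x hx)
  rcases hdiv.eventually_constant_or_nhds_le_map_nhds with hconst | hopen
  · have hq : (fun s => eval (u s) q) =ᶠ[nhds 0] 0 := by
      filter_upwards [hconst, hpos] with s hs hs'
      simpa [hu0, hzero, hf _ hs'] using hs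
    have := (han q).eqOn_zero_of_preconnected_of_eventuallyEq_zero isPreconnected_univ
      (Set.mem_univ 0) hq (Set.mem_univ 1)
    exact hy (hu1.symm.trans this)
  · have hnonpos : ∀ᶠ w in nhds (0 : ℂ), w.im ≤ 0 := by
      simp only [hu0, hzero, zero_div] at hopen
      refine hopen (Filter.mem_map.mpr ?_)
      filter_upwards [hpos] with s hs
      exact hf.im_pderiv_div_eval_nonpos hv hs
    have hlim : Filter.Tendsto (fun t : ℝ => (t : ℂ) * Complex.I) (nhdsWithin 0 (Set.Ioi 0))
        (nhds 0) := by
      refine Filter.Tendsto.mono_left ?_ nhdsWithin_le_nhds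
      exact Continuous.tendsto' (by fun_prop) _ _ (by simp)
    obtain ⟨t, ht, ht'⟩ := ((hlim.eventually hnonpos).and self_mem_nhdsWithin).exists
    simp at ht ht'
    linarith

end IsStable

/-- In the ring `ℂ[x_0,…,x_{n+1}, y_0,…,y_{n+1}, z_0,…,z_{n+1}]` (with
`x_i = X (0,i)`, `y_i = X (1,i)`, `z_i = X (2,i)`), the `ℂ`-derivation
`D_{n+1}` sending every variable of index `≤ n` to `x_{n+1} y_{n+1} z_{n+1}`
and the variables of index `n+1` to `0` maps every stable multiaffine
polynomial in the variables of index `≤ n` to a polynomial that is stable or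
identically zero. -/
theorem derivation_preserves_stability (n : ℕ)
    (D : Derivation ℂ (MvPolynomial (Fin 3 × ℕ) ℂ) (MvPolynomial (Fin 3 × ℕ) ℂ))
    (hD1 : ∀ (j : Fin 3) (i : ℕ), i ≤ n →
      D (X (j, i)) = X ((0 : Fin 3), n+1) * X ((1 : Fin 3), n+1) * X ((2 : Fin 3), n+1))
    (hD2 : ∀ j : Fin 3, D (X (j, n+1)) = 0)
    (f : MvPolynomial (Fin 3 × ℕ) ℂ)
    (hvars : ∀ m ∈ f.support, ∀ (j : Fin 3) (i : ℕ), m (j, i) ≠ 0 → i ≤ n)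
    (hmultiaffine : ∀ m ∈ f.support, ∀ v : Fin 3 × ℕ, m v ≤ 1)
    (hf : IsStable f) :
    IsStable (D f) ∨ D f = 0 := by
  by_cases hzero : ∀ v ∈ f.vars, MvPolynomial.pderiv v f = 0
  · right
    rw [derivation_eq_sum_vars]
    exact Finset.sum_eq_zero fun v hv => by rw [hzero v hv, mul_zero]
  · left
    push Not at hzero
    obtain ⟨v₀, hv₀, hne⟩ := hzero
    intro x hx
    have hD : D f = X (0, n + 1) * X (1, n + 1) * X (2, n + 1) *
        ∑ v ∈ f.vars, MvPolynomial.pderiv v f := by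
      rw [derivation_eq_sum_vars, Finset.mul_sum]
      refine Finset.sum_congr rfl fun v hv => ?_
      obtain ⟨m, hm, hmv⟩ := (mem_vars_iff_mem_support v).mp hv
      rw [hD1 v.1 v.2 (hvars m hm v.1 v.2 (Finsupp.mem_support_iff.mp hmv))]
    have hdeg (v) : ∀ m ∈ f.support, m v ≤ 1 := fun m hm => hmultiaffine m hm v
    have hneg : (∑ v ∈ f.vars, eval x (MvPolynomial.pderiv v f) / eval x f).im < 0 := by
      rw [Complex.im_sum]
      exact Finset.sum_neg' (fun v _ => hf.im_pderiv_div_eval_nonpos (hdeg v) hx)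
        ⟨v₀, hv₀, hf.im_pderiv_div_eval_neg (hdeg v₀) hx (hf.pderiv (hdeg v₀) hne x hx)⟩
    have hx0 (i) : x i ≠ 0 := fun h => by simpa [h] using hx i
    rw [hD]
    simp only [map_mul, eval_X, map_sum]
    refine mul_ne_zero (mul_ne_zero (mul_ne_zero (hx0 _) (hx0 _)) (hx0 _)) fun h => ?_
    rw [← Finset.sum_div, h] at hneg
    simp at hneg
end
end
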